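/- Suppose n > 36k and F ⊂ binom([n], k) is an intersecting family. Then the diversity γ(F) = min_{i ∈ [n]} |{F ∈ F : i ∉ F}| satisfies γ(F) ≤ C(n-3, k-2). -/

import Mathlib

open Finset
open scoped FinsetFamily

/-- Two families of finite sets are cross-`t`-intersecting. -/
def CrossT (t : ℕ) (A B : Finset (Finset ℕ)) : Prop :=
  ∀ F ∈ A, ∀ F' ∈ B, t ≤ (F ∩ F').card

/-- All members are `a`-subsets of `U`. -/
def Unif (U : Finset ℕ) (a : ℕ) (A : Finset (Finset ℕ)) : Prop :=
  ∀ F ∈ A, F ⊆ U ∧ F.card = a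

lemma Unif.card_le {U : Finset ℕ} {a : ℕ} {A : Finset (Finset ℕ)} (h : Unif U a A) :
    A.card ≤ U.card.choose a := by
  rw [← card_powersetCard]
  exact card_le_card fun F hF => mem_powersetCard.2 (h F hF)

/-- Kruskal-Katona for cross-intersecting families. -/
lemma kk_exact {U : Finset ℕ} {a b j : ℕ} {A B : Finset (Finset ℕ)}
    (hA : Unif U a A) (hB : Unif U b B) (hc : CrossT 1 A B)
    (hab : a + b ≤ U.card) (hj : j ≤ b)
    (hBc : (U.card - j).choose (b - j) ≤ B.card) :
    A.card + (U.card - j).choose a ≤ U.card.choose a := by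
  classical
  obtain ⟨N, hN⟩ : ∃ N, N = U.card := ⟨_, rfl⟩
  have e : U ≃ Fin N := U.equivFin.trans (finCongr hN.symm)
  -- transport
  let φ : Finset ℕ → Finset (Fin N) := fun F => univ.filter fun x => (e.symm x : ℕ) ∈ F
  have φinj : ∀ F, F ⊆ U → ∀ F', F' ⊆ U → φ F = φ F' → F = F' := by
    intro F hF F' hF' h
    ext x
    constructor
    · intro hx
      have : e ⟨x, hF hx⟩ ∈ φ F := by simp [φ, hx]
      rw [h] at this
      simpa [φ] using this
    · intro hx
      have : e ⟨x, hF' hx⟩ ∈ φ F' := by simp [φ, hx]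
      rw [← h] at this
      simpa [φ] using this
  have φcard : ∀ F, F ⊆ U → (φ F).card = F.card := by
    intro F hF
    symm
    refine Finset.card_bij (fun x hx => e ⟨x, hF hx⟩) ?_ ?_ ?_
    · intro x hx; simp [φ, hx]
    · intro x hx y hy h
      simpa using h
    · intro y hy
      refine ⟨(e.symm y : ℕ), by simpa [φ] using hy, by simp⟩
  let 𝓑 : Finset (Finset (Fin N)) := B.image fun F => φ (U \ F)
  have h𝓑c : 𝓑.card = B.card := by
    apply card_image_of_injOn
    intro F hF F' hF' h
    have h1 := φinj _ sdiff_subset _ sdiff_subset h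
    have hF1 := (hB F hF).1
    have hF1' := (hB F' hF').1
    rw [← Finset.sdiff_sdiff_eq_self hF1, h1, Finset.sdiff_sdiff_eq_self hF1']
  have h𝓑s : (𝓑 : Set (Finset (Fin N))).Sized (N - b) := by
    intro S hS
    simp only [𝓑, coe_image, Set.mem_image] at hS
    obtain ⟨F, hF, rfl⟩ := hS
    have hF := hB F hF
    rw [φcard _ sdiff_subset, card_sdiff_of_subset hF.1, hF.2, hN]
  have key := kruskal_katona_lovasz_form (n := N) (i := N - b - a) (r := N - b) (k := N - j)
    (𝒜 := 𝓑) (by omega) (by omega) (by omega) h𝓑s (by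
      rw [h𝓑c]
      have : (N - j).choose (N - b) = (U.card - j).choose (b - j) := by
        rw [← hN, ← Nat.choose_symm (n := N - j) (k := b - j) (by omega)]
        congr 1; omega
      rw [this]; exact hBc)
  have hsub : N - b - (N - b - a) = a := by omega
  rw [hsub] at key
  have hdis : Disjoint (A.image φ) (∂^[N - b - a] 𝓑) := by
    rw [Finset.disjoint_left]
    intro S hS hS'
    obtain ⟨F, hF, rfl⟩ := mem_image.1 hS
    rw [mem_shadow_iterate_iff_exists_sdiff] at hS'
    obtain ⟨S', hS', hsub, -⟩ := hS'
    obtain ⟨F', hF', rfl⟩ := mem_image.1 hS'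
    have h1 := hc F hF F' hF'
    obtain ⟨x, hx⟩ := card_pos.1 h1
    rw [mem_inter] at hx
    have hxU := (hA F hF).1 hx.1
    have : e ⟨x, hxU⟩ ∈ φ F := by simp [φ, hx.1]
    have := hsub this
    simp [φ, hx.2] at this
  have hAc : (A.image φ).card = A.card := by
    apply card_image_of_injOn
    intro F hF F' hF' h
    exact φinj _ (hA F hF).1 _ (hA F' hF').1 h
  have hle : (A.image φ ∪ ∂^[N - b - a] 𝓑) ⊆ powersetCard a (univ : Finset (Fin N)) := by
    intro S hS
    rw [mem_powersetCard]
    refine ⟨subset_univ _, ?_⟩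
    rcases mem_union.1 hS with h | h
    · obtain ⟨F, hF, rfl⟩ := mem_image.1 h
      rw [φcard _ (hA F hF).1, (hA F hF).2]
    · have := h𝓑s.shadow_iterate (k := N - b - a) h
      omega
  have := card_le_card hle
  rw [card_union_of_disjoint hdis, card_powersetCard, card_univ, Fintype.card_fin, hAc] at this
  rw [← hN]
  omega

lemma choose_sub_le (N a j : ℕ) (ha : 1 ≤ a) (hj : j ≤ N) :
    N.choose a ≤ (N - j).choose a + j * (N - 1).choose (a - 1) := by
  induction j with
  | zero => simp
  | succ j ih =>
    have h1 := ih (by omega)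
    obtain ⟨M, hM⟩ : ∃ M, N - j = M + 1 := ⟨N - j - 1, by omega⟩
    obtain ⟨c, rfl⟩ : ∃ c, a = c + 1 := ⟨a - 1, by omega⟩
    have h2 : N - (j + 1) = M := by omega
    rw [hM, Nat.choose_succ_succ] at h1
    rw [h2]
    have h3 : M.choose c ≤ (N - 1).choose c := Nat.choose_le_choose _ (by omega)
    simp only [Nat.add_sub_cancel] at *
    nlinarith

lemma kk_cross {U : Finset ℕ} {a b : ℕ} (j : ℕ) {A B : Finset (Finset ℕ)}
    (hA : Unif U a A) (hB : Unif U b B) (hc : CrossT 1 A B)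
    (ha : 1 ≤ a) (hab : a + b ≤ U.card)
    (hAc : j * (U.card - 1).choose (a - 1) < A.card) :
    B.card < (U.card - j).choose (b - j) := by
  by_contra! h
  have key : ∀ i, i ≤ b → i ≤ j → (U.card - i).choose (b - i) ≤ B.card → False := by
    intro i hib hij hi
    have h1 := kk_exact hA hB hc hab hib hi
    have h2 := choose_sub_le U.card a i ha (by omega)
    have : i * (U.card - 1).choose (a - 1) ≤ j * (U.card - 1).choose (a - 1) :=
      Nat.mul_le_mul_right _ hij
    omega
  rcases le_total j b with hjb | hjb
  · exact key j hjb le_rfl h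
  · apply key b le_rfl hjb
    have : b - j = 0 := by omega
    rw [this] at h
    simpa using h

lemma choose_mono_half {M r s : ℕ} (hrs : r ≤ s) (hs : 2 * s ≤ M) :
    M.choose r ≤ M.choose s := by
  induction s, hrs using Nat.le_induction with
  | base => rfl
  | succ s h ih =>
    exact (ih (by omega)).trans (Nat.choose_le_succ_of_lt_half_left (by omega))

/-- The weighted inequality used for the final triangle. -/
lemma weighted {U : Finset ℕ} {a b i : ℕ} {A B : Finset (Finset ℕ)}
    (hA : Unif U a A) (hB : Unif U b B) (hc : CrossT 1 A B)
    (ha : 1 ≤ a) (hb : b ≤ a + 2) (hi : b = a - 1 + i) (hm : 34 * a + 2 ≤ U.card)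
    (hBc : B.card < (U.card - i).choose (a - 1)) :
    A.card + 8 * B.card ≤ U.card.choose a := by
  classical
  rcases Nat.eq_zero_or_pos B.card with h0 | h0
  · rw [h0]; simpa using hA.card_le
  set m := U.card with hmdef
  have hex : ∃ j, (m - j).choose (b - j) ≤ B.card := ⟨b, by simpa using h0⟩
  obtain ⟨j, hj, hmin⟩ : ∃ j, (m - j).choose (b - j) ≤ B.card ∧
      ∀ j' < j, ¬ (m - j').choose (b - j') ≤ B.card :=
    ⟨Nat.find hex, Nat.find_spec hex, fun j' h => Nat.find_min hex h⟩
  have hjb : j ≤ b := by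
    by_contra! h
    exact hmin b h (by simpa using h0)
  have anti : ∀ x y, x ≤ y → y ≤ b → (m - y).choose (b - y) ≤ (m - x).choose (b - x) := by
    intro x y hxy hyb
    rw [← Nat.choose_symm (n := m - y) (by omega), ← Nat.choose_symm (n := m - x) (by omega)]
    have e1 : m - y - (b - y) = m - b := by omega
    have e2 : m - x - (b - x) = m - b := by omega
    rw [e1, e2]
    exact Nat.choose_le_choose _ (by omega)
  have hij : i < j := by
    by_contra! h
    have := anti j i h (by omega)
    have e : b - i = a - 1 := by omega
    rw [e] at this
    omega
  have h1 := kk_exact hA hB hc (by omega) hjb hj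
  have h2 := hmin (j - 1) (by omega)
  obtain ⟨M, hM⟩ : ∃ M, m - j = M := ⟨_, rfl⟩
  have e3 : m - (j - 1) = M + 1 := by omega
  rw [e3] at h2
  have h3 : (M + 1).choose (b - (j - 1)) ≤ (M + 1).choose (a - 1) :=
    choose_mono_half (by omega) (by omega)
  have h4 : (M + 1).choose (a - 1) ≤ 2 * M.choose (a - 1) := by
    obtain ⟨c, hc⟩ : ∃ c, c = a - 1 := ⟨_, rfl⟩
    rw [← hc]
    cases c with
    | zero => simp
    | succ c =>
      rw [Nat.choose_succ_succ']
      have := choose_mono_half (M := M) (r := c) (s := c + 1) (by omega) (by omega)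
      omega
  have h5 : 16 * M.choose (a - 1) ≤ M.choose a := by
    have := Nat.choose_succ_right_eq M (a - 1)
    have e : a - 1 + 1 = a := by omega
    rw [e] at this
    have h6 : 16 * a ≤ M - (a - 1) := by omega
    have : 16 * a * M.choose (a - 1) ≤ M.choose a * a := by
      rw [this, mul_comm]; exact Nat.mul_le_mul_left _ h6
    nlinarith
  rw [← hmdef] at h1
  rw [hM] at h1
  omega

/-- `A` is shifted (left-compressed) on the ground set `U`. -/
def Shifted (U : Finset ℕ) (A : Finset (Finset ℕ)) : Prop :=
  ∀ F ∈ A, ∀ i ∈ U, ∀ j ∈ F, i < j → i ∉ F → insert i (F.erase j) ∈ A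

lemma filter_lt_succ_of_notMem {S : Finset ℕ} {z : ℕ} (h : z ∉ S) :
    S.filter (· < z + 1) = S.filter (· < z) := by
  ext x
  simp only [mem_filter, and_congr_right_iff]
  intro hx
  have : x ≠ z := fun e => h (e ▸ hx)
  omega

lemma card_filter_insert_erase {F : Finset ℕ} {w z : ℕ} (hw : w ∉ F) (hz : z ∈ F) (hwz : w < z)
    (x : ℕ) : ((insert w (F.erase z)).filter (· < x)).card
      = (F.filter (· < x)).card + (if w < x ∧ x ≤ z then 1 else 0) := by
  have hw' : w ∉ (F.filter (· < x)).erase z := by simp [hw]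
  rw [filter_insert, filter_erase]
  by_cases h1 : w < x
  · rw [if_pos h1, card_insert_of_notMem hw']
    by_cases h2 : x ≤ z
    · rw [if_pos ⟨h1, h2⟩, erase_eq_of_notMem]
      simp; omega
    · rw [if_neg (by omega)]
      apply card_erase_add_one
      simp [hz]; omega
  · rw [if_neg h1, if_neg (by omega), erase_eq_of_notMem]
    · simp
    · simp; omega

lemma card_filter_add (F F' : Finset ℕ) (x : ℕ) :
    (F.filter (· < x)).card + (F'.filter (· < x)).card
      = ((F ∪ F').filter (· < x)).card + ((F ∩ F').filter (· < x)).card := by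
  rw [filter_union, filter_inter_distrib, card_union_add_card_inter]

lemma w_exists {U : Finset ℕ} {A B : Finset (Finset ℕ)} {t : ℕ} (ht : 1 ≤ t)
    (hs : Shifted U A) (hc : CrossT t A B)
    {F' : Finset ℕ} (hF' : F' ∈ B) (hFU' : F' ⊆ U) :
    ∀ m, ∀ F ∈ A, F ⊆ U → (F ∩ F').card = m →
    ∃ x, (U.filter (· < x)).card + t ≤ (F.filter (· < x)).card + (F'.filter (· < x)).card := by
  intro m
  induction m with
  | zero =>
    intro F hF hFU h0
    have := hc F hF F' hF'
    omega
  | succ m ih =>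
    intro F hF hFU hm
    by_contra! hv
    have hex : ∃ z, t ≤ ((F ∩ F').filter (· < z + 1)).card := by
      refine ⟨(F ∩ F').sup id, ?_⟩
      have : (F ∩ F').filter (· < (F ∩ F').sup id + 1) = F ∩ F' := by
        apply filter_true_of_mem
        intro x hx
        have : x ≤ (F ∩ F').sup id := Finset.le_sup (f := id) hx
        omega
      rw [this]; exact hc F hF F' hF'
    obtain ⟨z, hz, hmin⟩ : ∃ z, t ≤ ((F ∩ F').filter (· < z + 1)).card ∧
        ((F ∩ F').filter (· < z)).card < t := by
      refine ⟨Nat.find hex, Nat.find_spec hex, ?_⟩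
      rcases Nat.eq_zero_or_pos (Nat.find hex) with h | h
      · rw [h]; simp; omega
      · obtain ⟨y, hy⟩ : ∃ y, Nat.find hex = y + 1 := ⟨Nat.find hex - 1, by omega⟩
        have := Nat.find_min hex (m := y) (by omega)
        rw [hy]; omega
    have hzm : z ∈ F ∩ F' := by
      by_contra h
      rw [filter_lt_succ_of_notMem h] at hz
      omega
    have hzF := (mem_inter.1 hzm).1
    have hzF' := (mem_inter.1 hzm).2
    have h1 := hv (z + 1)
    rw [card_filter_add] at h1
    have h2 : ((F ∪ F').filter (· < z + 1)).card < (U.filter (· < z + 1)).card := by omega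
    obtain ⟨w, hwU, hwn⟩ := exists_mem_notMem_of_card_lt_card h2
    simp only [mem_filter, mem_union] at hwU hwn
    have hwF : w ∉ F := fun h => hwn ⟨Or.inl h, hwU.2⟩
    have hwF' : w ∉ F' := fun h => hwn ⟨Or.inr h, hwU.2⟩
    have hwz : w < z := by
      have : w ≠ z := fun e => hwF (e ▸ hzF)
      omega
    have hF1 := hs F hF w hwU.1 z hzF hwz hwF
    obtain ⟨x, hx⟩ := ih _ hF1 (by
        intro y hy
        rcases mem_insert.1 hy with rfl | hy
        · exact hwU.1
        · exact hFU (mem_of_mem_erase hy)) (by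
        have : insert w (F.erase z) ∩ F' = (F ∩ F').erase z := by
          rw [insert_inter_of_notMem hwF', erase_inter]
        rw [this, card_erase_of_mem hzm, hm]; rfl)
    rw [card_filter_insert_erase hwF hzF hwz] at hx
    split_ifs at hx with hwx
    · have h3 := card_filter_add F F' x
      have h4 : ((F ∪ F').filter (· < x)).card < (U.filter (· < x)).card := by
        apply card_lt_card
        refine ⟨filter_subset_filter _ (union_subset hFU hFU'), fun h => ?_⟩
        have := h (mem_filter.2 ⟨hwU.1, hwx.1⟩)
        simp [hwF, hwF'] at this
      have h5 : ((F ∩ F').filter (· < x)).card ≤ ((F ∩ F').filter (· < z)).card := by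
        apply card_le_card
        intro y hy
        simp only [mem_filter] at hy ⊢
        exact ⟨hy.1, by omega⟩
      omega
    · have := hv x
      omega

lemma w_count (U : Finset ℕ) : ∀ (t a : ℕ) (A : Finset (Finset ℕ)), t ≤ a →
    (∀ F ∈ A, F ⊆ U ∧ F.card = a ∧
      ∃ x, (U.filter (· < x)).card + t ≤ 2 * (F.filter (· < x)).card) →
    A.card ≤ U.card.choose (a - t) := by
  classical
  induction U using Finset.induction_on_min with
  | empty =>
    intro t a A hta hA
    have hsub : A ⊆ {∅} := by
      intro F hF
      rw [mem_singleton]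
      exact subset_empty.1 (hA F hF).1
    rcases A.eq_empty_or_nonempty with rfl | ⟨F, hF⟩
    · simp
    · have h := hA F hF
      have : F = ∅ := subset_empty.1 h.1
      have ha : a = 0 := by rw [← h.2.1, this]; rfl
      have : a - t = 0 := by omega
      rw [this]
      simpa using card_le_card hsub
  | insert u S hu ih =>
    intro t a A hta hA
    have huS : u ∉ S := fun h => lt_irrefl _ (hu u h)
    have hUcard : (insert u S).card = S.card + 1 := card_insert_of_notMem huS
    rcases Nat.eq_zero_or_pos t with rfl | ht
    · exact Unif.card_le (U := insert u S) (fun F hF => ⟨(hA F hF).1, (hA F hF).2.1⟩)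
    have hx : ∀ F ∈ A, ∃ x, u < x ∧ (S.filter (· < x)).card + 1 + t
        ≤ 2 * (F.filter (· < x)).card := by
      intro F hF
      obtain ⟨h1, h2, x, h3⟩ := hA F hF
      by_cases hux : u < x
      · refine ⟨x, hux, ?_⟩
        rw [filter_insert, if_pos hux, card_insert_of_notMem (by simp [huS])] at h3
        exact h3
      · exfalso
        have : F.filter (· < x) = ∅ := by
          apply filter_eq_empty_iff.2
          intro y hy
          rcases mem_insert.1 (h1 hy) with rfl | h
          · exact hux
          · have := hu y h; omega
        rw [this] at h3
        simp at h3
        omega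
    rw [← card_filter_add_card_filter_not (s := A) (fun F => u ∈ F)]
    have c1 : (A.filter (fun F => u ∈ F)).card ≤ S.card.choose (a - t) := by
      have hinj : ((A.filter (fun F => u ∈ F)).image (fun F => F.erase u)).card
          = (A.filter (fun F => u ∈ F)).card := by
        apply card_image_of_injOn
        intro F hF F' hF' h
        simp only [coe_filter, Set.mem_ofPred_eq] at hF hF'
        rw [← insert_erase hF.2, ← insert_erase hF'.2]
        simp only at h
        rw [h]
      rw [← hinj]
      have e : a - t = (a - 1) - (t - 1) := by omega
      rw [e]
      apply ih _ _ _ (by omega)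
      intro G hG
      obtain ⟨F, hF, rfl⟩ := mem_image.1 hG
      obtain ⟨hF, huF⟩ := mem_filter.1 hF
      obtain ⟨h1, h2, -⟩ := hA F hF
      obtain ⟨x, hux, hx⟩ := hx F hF
      refine ⟨?_, by rw [card_erase_of_mem huF, h2], x, ?_⟩
      · intro y hy
        rcases mem_insert.1 (h1 (mem_of_mem_erase hy)) with rfl | h
        · simp at hy
        · exact h
      · rw [filter_erase]
        have := card_erase_add_one (s := F.filter (· < x)) (a := u) (by simp [huF, hux])
        omega
    have hG : ∀ F ∈ A.filter (fun F => ¬ u ∈ F), F ⊆ S ∧ F.card = a ∧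
        ∃ x, (S.filter (· < x)).card + (t + 1) ≤ 2 * (F.filter (· < x)).card := by
      intro F hF
      obtain ⟨hF, huF⟩ := mem_filter.1 hF
      obtain ⟨h1, h2, -⟩ := hA F hF
      obtain ⟨x, hux, hx⟩ := hx F hF
      refine ⟨?_, h2, x, by omega⟩
      intro y hy
      rcases mem_insert.1 (h1 hy) with rfl | h
      · exact absurd hy huF
      · exact h
    rw [hUcard]
    rcases Nat.lt_or_ge t a with hlt | hge
    · have c2 := ih (t + 1) a _ hlt hG
      have e : a - t = a - (t + 1) + 1 := by omega
      rw [e] at c1 ⊢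
      rw [Nat.choose_succ_succ']
      omega
    · have : A.filter (fun F => ¬ u ∈ F) = ∅ := by
        apply eq_empty_of_forall_notMem
        intro F hF
        obtain ⟨h1, h2, x, h3⟩ := hG F hF
        have h4 : (F.filter (· < x)).card ≤ (S.filter (· < x)).card :=
          card_le_card (filter_subset_filter _ h1)
        have h5 : (F.filter (· < x)).card ≤ F.card := card_le_card (filter_subset _ _)
        omega
      rw [this]
      have e : a - t = 0 := by omega
      rw [e] at c1 ⊢
      simpa using c1

lemma shifted_cross {U : Finset ℕ} {a t : ℕ} {A B : Finset (Finset ℕ)} (ht : 1 ≤ t) (hta : t ≤ a)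
    (hA : Unif U a A) (hB : Unif U a B) (hs : Shifted U A) (hc : CrossT t A B) :
    A.card ≤ U.card.choose (a - t) ∨ B.card ≤ U.card.choose (a - t) := by
  by_cases h : ∀ F ∈ A, ∃ x, (U.filter (· < x)).card + t ≤ 2 * (F.filter (· < x)).card
  · left
    exact w_count U t a A hta fun F hF => ⟨(hA F hF).1, (hA F hF).2, h F hF⟩
  · right
    push Not at h
    obtain ⟨F, hF, hF2⟩ := h
    apply w_count U t a B hta
    intro F' hF'
    refine ⟨(hB F' hF').1, (hB F' hF').2, ?_⟩
    obtain ⟨x, hx⟩ := w_exists ht hs hc hF' (hB F' hF').1 _ F hF (hA F hF).1 rfl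
    refine ⟨x, ?_⟩
    have := hF2 x
    omega

lemma shifted_avoid {U : Finset ℕ} {A : Finset (Finset ℕ)} (hs : Shifted U A) (y : ℕ) :
    Shifted (U.erase y) (A.filter (fun F => y ∉ F)) := by
  intro F hF i hi j hj hij hiF
  obtain ⟨hF, hy⟩ := mem_filter.1 hF
  have := ne_of_mem_erase hi
  rw [mem_filter]
  refine ⟨hs F hF i (mem_of_mem_erase hi) j hj hij hiF, ?_⟩
  simp [hy, this.symm]

lemma unif_avoid {U : Finset ℕ} {a : ℕ} {A : Finset (Finset ℕ)} (hA : Unif U a A) (y : ℕ) :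
    Unif (U.erase y) a (A.filter (fun F => y ∉ F)) := by
  intro F hF
  obtain ⟨hF, hy⟩ := mem_filter.1 hF
  exact ⟨subset_erase.2 ⟨(hA F hF).1, hy⟩, (hA F hF).2⟩

lemma cross_avoid {U : Finset ℕ} {a t y : ℕ} {A B : Finset (Finset ℕ)} (ht : 1 ≤ t)
    (hA : Unif U a A) (hs : Shifted U A) (hc : CrossT t A B) (hy : y ∈ U)
    (hmin : ∀ x ∈ U, y ≤ x) :
    CrossT (t + 1) (A.filter (fun F => y ∉ F)) (B.filter (fun F => y ∉ F)) := by
  intro F hF F' hF'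
  obtain ⟨hF, hyF⟩ := mem_filter.1 hF
  obtain ⟨hF', hyF'⟩ := mem_filter.1 hF'
  by_contra! h
  have h1 := hc F hF F' hF'
  obtain ⟨z, hz⟩ : (F ∩ F').Nonempty := card_pos.1 (by omega)
  have hzF := (mem_inter.1 hz).1
  have hyz : y < z := by
    have := hmin z ((hA F hF).1 hzF)
    have : y ≠ z := fun e => hyF (e ▸ hzF)
    omega
  have h2 := hc _ (hs F hF y hy z hzF hyz hyF) F' hF'
  rw [insert_inter_of_notMem hyF', erase_inter, card_erase_of_mem hz] at h2
  omega

/-- The elementary shift of one set relative to a family. -/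
def shiftF (i j : ℕ) (A : Finset (Finset ℕ)) (F : Finset ℕ) : Finset ℕ :=
  if j ∈ F ∧ i ∉ F ∧ insert i (F.erase j) ∉ A then insert i (F.erase j) else F

/-- The elementary shift of a family. -/
def shiftS (i j : ℕ) (A : Finset (Finset ℕ)) : Finset (Finset ℕ) := A.image (shiftF i j A)

lemma shiftF_cases (i j : ℕ) (A : Finset (Finset ℕ)) (F : Finset ℕ) :
    (j ∈ F ∧ i ∉ F ∧ insert i (F.erase j) ∉ A ∧ shiftF i j A F = insert i (F.erase j)) ∨
    ((j ∈ F → i ∉ F → insert i (F.erase j) ∈ A) ∧ shiftF i j A F = F) := by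
  unfold shiftF
  split_ifs with h
  · exact Or.inl ⟨h.1, h.2.1, h.2.2, rfl⟩
  · refine Or.inr ⟨fun h1 h2 => ?_, rfl⟩
    by_contra h3
    exact h ⟨h1, h2, h3⟩

lemma shift_move_inj {i j : ℕ} (hij : i ≠ j) {F F' : Finset ℕ} (h1 : j ∈ F) (h2 : i ∉ F)
    (h1' : j ∈ F') (h2' : i ∉ F') (h : insert i (F.erase j) = insert i (F'.erase j)) : F = F' := by
  ext x
  have := congrArg (fun S => x ∈ S) h
  simp only [mem_insert, mem_erase, eq_iff_iff] at this
  by_cases hxi : x = i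
  · subst hxi; tauto
  · by_cases hxj : x = j
    · subst hxj; tauto
    · tauto

lemma shiftF_injOn {i j : ℕ} (hij : i ≠ j) (A : Finset (Finset ℕ)) :
    Set.InjOn (shiftF i j A) A := by
  intro F hF F' hF' h
  rcases shiftF_cases i j A F with ⟨h1, h2, h3, h4⟩ | ⟨h1, h4⟩ <;>
  rcases shiftF_cases i j A F' with ⟨h1', h2', h3', h4'⟩ | ⟨h1', h4'⟩
  · rw [h4, h4'] at h
    exact shift_move_inj hij h1 h2 h1' h2' h
  · rw [h4, h4'] at h
    exact absurd (h ▸ hF') h3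
  · rw [h4, h4'] at h
    exact absurd (h ▸ hF) h3'
  · rw [h4, h4'] at h
    exact h

lemma shiftS_card {i j : ℕ} (hij : i ≠ j) (A : Finset (Finset ℕ)) :
    (shiftS i j A).card = A.card := card_image_of_injOn (shiftF_injOn hij A)

lemma shiftS_unif {U : Finset ℕ} {a i j : ℕ} {A : Finset (Finset ℕ)} (hA : Unif U a A)
    (hi : i ∈ U) : Unif U a (shiftS i j A) := by
  intro G hG
  obtain ⟨F, hF, rfl⟩ := mem_image.1 hG
  have := hA F hF
  rcases shiftF_cases i j A F with ⟨h1, h2, h3, h4⟩ | ⟨h1, h4⟩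
  · rw [h4]
    refine ⟨insert_subset hi ((erase_subset _ _).trans this.1), ?_⟩
    rw [card_insert_of_notMem (by simp [h2]), card_erase_add_one h1, this.2]
  · rw [h4]; exact this

lemma cross_iff {A B : Finset (Finset ℕ)} :
    CrossT 1 A B ↔ ∀ F ∈ A, ∀ F' ∈ B, ∃ x, x ∈ F ∧ x ∈ F' := by
  constructor
  · intro h F hF F' hF'
    obtain ⟨x, hx⟩ := card_pos.1 (h F hF F' hF')
    exact ⟨x, mem_inter.1 hx⟩
  · intro h F hF F' hF'
    obtain ⟨x, hx⟩ := h F hF F' hF'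
    exact card_pos.2 ⟨x, mem_inter.2 hx⟩

lemma cross_symm {A B : Finset (Finset ℕ)} (h : CrossT 1 A B) : CrossT 1 B A := by
  rw [cross_iff] at *
  intro F hF F' hF'
  obtain ⟨x, hx⟩ := h F' hF' F hF
  exact ⟨x, hx.symm⟩

lemma shift_mixed {i j : ℕ} {A B : Finset (Finset ℕ)} (hc : CrossT 1 A B)
    {F F' : Finset ℕ} (hF : F ∈ A) (hF' : F' ∈ B) (h2 : i ∉ F)
    (h1' : j ∈ F' → i ∉ F' → insert i (F'.erase j) ∈ B) :
    ∃ x, x ∈ insert i (F.erase j) ∧ x ∈ F' := by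
  rw [cross_iff] at hc
  by_cases hi : i ∈ F'
  · exact ⟨i, by simp, hi⟩
  obtain ⟨x, hx, hx'⟩ := hc F hF F' hF'
  by_cases hxj : x = j
  · subst hxj
    obtain ⟨y, hy, hy'⟩ := hc F hF _ (h1' hx' hi)
    have hyi : y ≠ i := fun e => h2 (e ▸ hy)
    simp only [mem_insert, hyi, false_or, mem_erase] at hy'
    exact ⟨y, by simp [hy'.1, hy], hy'.2⟩
  · exact ⟨x, by simp [hxj, hx], hx'⟩

lemma shiftS_cross {i j : ℕ} {A B : Finset (Finset ℕ)} (hc : CrossT 1 A B) :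
    CrossT 1 (shiftS i j A) (shiftS i j B) := by
  rw [cross_iff]
  intro G hG G' hG'
  obtain ⟨F, hF, rfl⟩ := mem_image.1 hG
  obtain ⟨F', hF', rfl⟩ := mem_image.1 hG'
  rcases shiftF_cases i j A F with ⟨h1, h2, h3, h4⟩ | ⟨h1, h4⟩ <;>
  rcases shiftF_cases i j B F' with ⟨h1', h2', h3', h4'⟩ | ⟨h1', h4'⟩ <;> rw [h4, h4']
  · exact ⟨i, by simp, by simp⟩
  · exact shift_mixed hc hF hF' h2 h1'
  · obtain ⟨x, hx⟩ := shift_mixed (cross_symm hc) hF' hF h2' h1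
    exact ⟨x, hx.symm⟩
  · exact cross_iff.1 hc F hF F' hF'

/-- Degree of a vertex in a family. -/
def deg (v : ℕ) (A : Finset (Finset ℕ)) : ℕ := (A.filter (fun F => v ∈ F)).card

lemma deg_shift_le {i j v : ℕ} (hv : v ≠ i) (A : Finset (Finset ℕ)) :
    deg v (shiftS i j A) ≤ deg v A := by
  unfold deg shiftS
  rw [filter_image]
  refine card_image_le.trans (card_le_card ?_)
  intro F hF
  simp only [mem_filter] at hF ⊢
  refine ⟨hF.1, ?_⟩
  rcases shiftF_cases i j A F with ⟨h1, h2, h3, h4⟩ | ⟨h1, h4⟩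
  · have := hF.2
    rw [h4] at this
    simp only [mem_insert, hv, false_or, mem_erase] at this
    exact this.2
  · rw [h4] at hF; exact hF.2

lemma deg_shift_i {i j : ℕ} (A : Finset (Finset ℕ)) :
    deg i (shiftS i j A) ≤ deg i A + deg j A := by
  unfold deg shiftS
  rw [filter_image]
  refine card_image_le.trans ?_
  refine le_trans (card_le_card ?_) (card_union_le _ _)
  intro F hF
  simp only [mem_filter, mem_union] at hF ⊢
  rcases shiftF_cases i j A F with ⟨h1, h2, h3, h4⟩ | ⟨h1, h4⟩
  · exact Or.inr ⟨hF.1, h1⟩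
  · rw [h4] at hF; exact Or.inl hF

lemma deg_shift_eq {i j v : ℕ} (hij : i ≠ j) (hv : v ≠ i) (hvj : v ≠ j)
    (A : Finset (Finset ℕ)) : deg v (shiftS i j A) = deg v A := by
  unfold deg shiftS
  rw [filter_image, card_image_of_injOn]
  · congr 1
    apply filter_congr
    intro F hF
    rcases shiftF_cases i j A F with ⟨h1, h2, h3, h4⟩ | ⟨h1, h4⟩
    · rw [h4]
      simp [hv, hvj]
    · rw [h4]
  · exact (shiftF_injOn hij A).mono (coe_subset.2 (filter_subset _ _))

/-- Total weight of a family. -/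
def wt (A : Finset (Finset ℕ)) : ℕ := ∑ F ∈ A, ∑ x ∈ F, x

lemma wt_shift {i j : ℕ} (hij : i < j) (A : Finset (Finset ℕ)) :
    wt (shiftS i j A) < wt A ∨ (wt (shiftS i j A) = wt A ∧
      ∀ F ∈ A, j ∈ F → i ∉ F → insert i (F.erase j) ∈ A) := by
  have h0 : wt (shiftS i j A) = ∑ F ∈ A, ∑ x ∈ shiftF i j A F, x := by
    unfold wt shiftS
    exact sum_image (shiftF_injOn hij.ne A)
  have hlt : ∀ F, j ∈ F → i ∉ F → ∑ x ∈ insert i (F.erase j), x < ∑ x ∈ F, x := by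
    intro F h1 h2
    rw [sum_insert (by simp [h2]), ← add_sum_erase F (fun x => x) h1]
    simpa using hij
  have hle : ∀ F ∈ A, ∑ x ∈ shiftF i j A F, x ≤ ∑ x ∈ F, x := by
    intro F hF
    rcases shiftF_cases i j A F with ⟨h1, h2, h3, h4⟩ | ⟨h1, h4⟩
    · rw [h4]; exact (hlt F h1 h2).le
    · rw [h4]
  by_cases h : ∀ F ∈ A, j ∈ F → i ∉ F → insert i (F.erase j) ∈ A
  · right
    refine ⟨?_, h⟩
    rw [h0]
    unfold wt
    apply sum_congr rfl
    intro F hF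
    rcases shiftF_cases i j A F with ⟨h1, h2, h3, h4⟩ | ⟨h1, h4⟩
    · exact absurd (h F hF h1 h2) h3
    · rw [h4]
  · left
    push Not at h
    obtain ⟨F, hF, h1, h2, h3⟩ := h
    rw [h0]
    apply sum_lt_sum hle
    refine ⟨F, hF, ?_⟩
    rcases shiftF_cases i j A F with ⟨h1, h2, h3, h4⟩ | ⟨h1', h4⟩
    · rw [h4]; exact hlt F h1 h2
    · exact absurd (h1' h1 h2) h3

/-- Minimal-weight pairs in a shift-closed class are stable. -/
lemma exists_stable (U : Finset ℕ) (P : Finset (Finset ℕ) → Finset (Finset ℕ) → Prop)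
    (hP : ∀ A B, P A B → ∀ i ∈ U, ∀ j ∈ U, i < j → P (shiftS i j A) (shiftS i j B)) :
    ∀ m A B, wt A + wt B = m → P A B → ∃ A' B', P A' B' ∧
      (∀ F ∈ A', ∀ i ∈ U, ∀ j ∈ U, i < j → j ∈ F → i ∉ F → insert i (F.erase j) ∈ A') ∧
      (∀ F ∈ B', ∀ i ∈ U, ∀ j ∈ U, i < j → j ∈ F → i ∉ F → insert i (F.erase j) ∈ B') := by
  intro m
  induction m using Nat.strong_induction_on with
  | _ m ih =>
    intro A B hm hAB
    by_cases h : ∃ i ∈ U, ∃ j ∈ U, i < j ∧ wt (shiftS i j A) + wt (shiftS i j B) < m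
    · obtain ⟨i, hi, j, hj, hij, hlt⟩ := h
      exact ih _ hlt _ _ rfl (hP A B hAB i hi j hj hij)
    · push Not at h
      refine ⟨A, B, hAB, ?_, ?_⟩
      · intro F hF i hi j hj hij
        have h1 := h i hi j hj hij
        rcases wt_shift hij A with h2 | h2 <;> rcases wt_shift hij B with h3 | h3
        · omega
        · omega
        · omega
        · exact h2.2 F hF
      · intro F hF i hi j hj hij
        have h1 := h i hi j hj hij
        rcases wt_shift hij A with h2 | h2 <;> rcases wt_shift hij B with h3 | h3
        · omega
        · omega
        · omega
        · exact h3.2 F hF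

lemma trace_card {T P : Finset ℕ} {A : Finset (Finset ℕ)} (hT : ∀ F ∈ A, F ∩ T = P) :
    (A.image (· \ T)).card = A.card := by
  apply card_image_of_injOn
  intro F hF F' hF' h
  rw [← sdiff_union_inter F T, ← sdiff_union_inter F' T, hT F hF, hT F' hF']
  simp only at h
  rw [h]

lemma trace_unif {V T P : Finset ℕ} {k : ℕ} {A : Finset (Finset ℕ)} (hA : Unif V k A)
    (hT : ∀ F ∈ A, F ∩ T = P) : Unif (V \ T) (k - P.card) (A.image (· \ T)) := by
  intro G hG
  obtain ⟨F, hF, rfl⟩ := mem_image.1 hG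
  refine ⟨sdiff_subset_sdiff (hA F hF).1 le_rfl, ?_⟩
  have := card_sdiff_add_card_inter F T
  rw [hT F hF, (hA F hF).2] at this
  omega

lemma trace_cross {T P Q : Finset ℕ} {A B : Finset (Finset ℕ)} (hc : CrossT 1 A B)
    (hA : ∀ F ∈ A, F ∩ T = P) (hB : ∀ F ∈ B, F ∩ T = Q) (hd : Disjoint P Q) :
    CrossT 1 (A.image (· \ T)) (B.image (· \ T)) := by
  rw [cross_iff] at *
  intro G hG G' hG'
  obtain ⟨F, hF, rfl⟩ := mem_image.1 hG
  obtain ⟨F', hF', rfl⟩ := mem_image.1 hG'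
  obtain ⟨x, hx, hx'⟩ := hc F hF F' hF'
  have : x ∉ T := by
    intro hxT
    have h1 : x ∈ P := by rw [← hA F hF]; exact mem_inter.2 ⟨hx, hxT⟩
    have h2 : x ∈ Q := by rw [← hB F' hF']; exact mem_inter.2 ⟨hx', hxT⟩
    exact disjoint_left.1 hd h1 h2
  exact ⟨x, by simp [hx, this], by simp [hx', this]⟩

lemma trace_avoid {T P : Finset ℕ} {A : Finset (Finset ℕ)} (hT : ∀ F ∈ A, F ∩ T = P) {z : ℕ}
    (hz : z ∉ T) :
    ((A.image (· \ T)).filter (fun F => z ∉ F)).card = (A.filter (fun F => z ∉ F)).card := by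
  rw [filter_image]
  have : A.filter (fun F => z ∉ F \ T) = A.filter (fun F => z ∉ F) := by
    apply filter_congr
    intro F hF
    simp [hz]
  rw [this]
  exact trace_card (P := P) fun F hF => hT F (mem_filter.1 hF).1

/-- Members of `A` containing all of `I` and avoiding all of `O`. -/
def fam (A : Finset (Finset ℕ)) (I O : List ℕ) : Finset (Finset ℕ) :=
  A.filter (fun F => (∀ x ∈ I, x ∈ F) ∧ ∀ x ∈ O, x ∉ F)

/-- The number of members of `A` containing all of `I` and avoiding all of `O`. -/
def cl (A : Finset (Finset ℕ)) (I O : List ℕ) : ℕ := (fam A I O).card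

lemma cl_split (A : Finset (Finset ℕ)) (I O : List ℕ) (x : ℕ) :
    cl A I O = cl A (x :: I) O + cl A I (x :: O) := by
  unfold cl fam
  rw [← card_filter_add_card_filter_not (s := A.filter _) (fun F => x ∈ F), filter_filter,
    filter_filter]
  congr 2 <;> apply filter_congr <;> intro F hF <;> simp <;> tauto

lemma cl_congr (A : Finset (Finset ℕ)) {I O I' O' : List ℕ} (hI : ∀ x, x ∈ I ↔ x ∈ I')
    (hO : ∀ x, x ∈ O ↔ x ∈ O') : cl A I O = cl A I' O' := by
  unfold cl fam
  congr 1
  apply filter_congr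
  intro F hF
  simp only [hI, hO]

lemma cl_mono (A : Finset (Finset ℕ)) {I O I' O' : List ℕ} (hI : ∀ x ∈ I, x ∈ I')
    (hO : ∀ x ∈ O, x ∈ O') : cl A I' O' ≤ cl A I O := by
  unfold cl fam
  apply card_le_card
  intro F hF
  simp only [mem_filter] at *
  exact ⟨hF.1, fun x hx => hF.2.1 x (hI x hx), fun x hx => hF.2.2 x (hO x hx)⟩

lemma cl_nil (A : Finset (Finset ℕ)) : cl A [] [] = A.card := by
  simp [cl, fam]

lemma cl_deg (A : Finset (Finset ℕ)) (v : ℕ) : cl A [v] [] = deg v A := by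
  simp [cl, fam, deg]

lemma fam_trace {A : Finset (Finset ℕ)} {I O : List ℕ} {T : Finset ℕ}
    (hT : ∀ x, x ∈ T ↔ x ∈ I ∨ x ∈ O) :
    ∀ F ∈ fam A I O, F ∩ T = I.toFinset := by
  intro F hF
  simp only [fam, mem_filter] at hF
  ext x
  simp only [mem_inter, hT, List.mem_toFinset]
  constructor
  · rintro ⟨h1, h2 | h2⟩
    · exact h2
    · exact absurd h1 (hF.2.2 x h2)
  · intro h
    exact ⟨hF.2.1 x h, Or.inl h⟩

lemma fam_avoid (A : Finset (Finset ℕ)) (I O : List ℕ) (z : ℕ) :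
    (fam A I O).filter (fun F => z ∉ F) = fam A I (z :: O) := by
  unfold fam
  rw [filter_filter]
  apply filter_congr
  intro F hF
  simp
  tauto

lemma fam_unif {V : Finset ℕ} {k : ℕ} {A : Finset (Finset ℕ)} (hA : Unif V k A) (I O : List ℕ) :
    Unif V k (fam A I O) := fun F hF => hA F (mem_filter.1 hF).1

lemma fam_cross {A : Finset (Finset ℕ)} (h : CrossT 1 A A) (I O I' O' : List ℕ) :
    CrossT 1 (fam A I O) (fam A I' O') :=
  fun F hF F' hF' => h F (mem_filter.1 hF).1 F' (mem_filter.1 hF').1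

/-- All link data of two disjoint traces. -/
lemma link_pair {V : Finset ℕ} {k : ℕ} {𝓕 : Finset (Finset ℕ)} (hF : Unif V k 𝓕)
    (hi : CrossT 1 𝓕 𝓕) (I O I' O' : List ℕ) (hn : (I ++ O).Nodup) (hn' : (I' ++ O').Nodup)
    (hV : ∀ x ∈ I ++ O, x ∈ V)
    (hT : ∀ x, x ∈ I ∨ x ∈ O ↔ x ∈ I' ∨ x ∈ O') (hd : ∀ x ∈ I, x ∉ I') :
    ∃ (U : Finset ℕ) (A B : Finset (Finset ℕ)), U = V \ (I ++ O).toFinset ∧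
      U.card = V.card - (I.length + O.length) ∧
      Unif U (k - I.length) A ∧ Unif U (k - I'.length) B ∧ CrossT 1 A B ∧
      A.card = cl 𝓕 I O ∧ B.card = cl 𝓕 I' O' ∧
      (∀ z ∈ U, (A.filter (fun F => z ∉ F)).card = cl 𝓕 I (z :: O)) ∧
      (∀ z ∈ U, (B.filter (fun F => z ∉ F)).card = cl 𝓕 I' (z :: O')) := by
  obtain ⟨T, hTd⟩ : ∃ T, T = (I ++ O).toFinset := ⟨_, rfl⟩
  have hT1 : ∀ x, x ∈ T ↔ x ∈ I ∨ x ∈ O := by intro x; simp [hTd]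
  have hT2 : ∀ x, x ∈ T ↔ x ∈ I' ∨ x ∈ O' := fun x => (hT1 x).trans (hT x)
  have t1 := fam_trace (A := 𝓕) hT1
  have t2 := fam_trace (A := 𝓕) hT2
  have hIc : I.toFinset.card = I.length := List.toFinset_card_of_nodup (List.nodup_append.1 hn).1
  have hIc' : I'.toFinset.card = I'.length :=
    List.toFinset_card_of_nodup (List.nodup_append.1 hn').1
  refine ⟨V \ T, (fam 𝓕 I O).image (· \ T), (fam 𝓕 I' O').image (· \ T), by rw [hTd], ?_, ?_, ?_,
    ?_, trace_card t1, trace_card t2, ?_, ?_⟩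
  · rw [card_sdiff_of_subset, hTd, List.toFinset_card_of_nodup hn, List.length_append]
    intro x hx
    apply hV
    simpa [hTd] using hx
  · rw [← hIc]; exact trace_unif (fam_unif hF _ _) t1
  · rw [← hIc']; exact trace_unif (fam_unif hF _ _) t2
  · apply trace_cross (fam_cross hi _ _ _ _) t1 t2
    rw [disjoint_left]
    intro x hx hx'
    exact hd x (by simpa using hx) (by simpa using hx')
  · intro z hz
    rw [trace_avoid t1 (mem_sdiff.1 hz).2, fam_avoid]; rfl
  · intro z hz
    rw [trace_avoid t2 (mem_sdiff.1 hz).2, fam_avoid]; rfl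

lemma deg_add_avoid (v : ℕ) (A : Finset (Finset ℕ)) :
    deg v A + (A.filter (fun F => v ∉ F)).card = A.card :=
  card_filter_add_card_filter_not (s := A) (fun F => v ∈ F)

lemma heavy_avoid {U : Finset ℕ} {n k z : ℕ} (hk : 3 ≤ k) (hn : 36 * k < n) (hU : U.card = n - 2)
    {A B : Finset (Finset ℕ)} (hA : Unif U (k - 1) A) (hB : Unif U (k - 1) B)
    (hc : CrossT 1 A B) (hz : z ∈ U) (h : 2 * (n - 3).choose (k - 3) < deg z A) :
    (B.filter (fun F => z ∉ F)).card < (n - 3).choose (k - 3) := by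
  have t1 : ∀ F ∈ A.filter (fun F => z ∈ F), F ∩ {z} = {z} := by
    intro F hF
    exact inter_singleton_of_mem (mem_filter.1 hF).2
  have t2 : ∀ F ∈ B.filter (fun F => z ∉ F), F ∩ {z} = ∅ := by
    intro F hF
    exact inter_singleton_of_notMem (mem_filter.1 hF).2
  have u1 := trace_unif (fun F hF => hA F (mem_filter.1 hF).1) t1
  have u2 := trace_unif (fun F hF => hB F (mem_filter.1 hF).1) t2
  have c := trace_cross (fun F hF F' hF' => hc F (mem_filter.1 hF).1 F' (mem_filter.1 hF').1)
    t1 t2 (by simp)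
  have hc1 := trace_card t1
  have hc2 := trace_card t2
  have hUc : (U \ {z}).card = n - 3 := by
    rw [card_sdiff_of_subset (by simpa using hz), hU, card_singleton]; omega
  rw [card_singleton] at u1
  rw [card_empty] at u2
  have key := kk_cross 2 u1 u2 c (by omega) (by omega) (by
    rw [hUc, hc1]
    have e : k - 1 - 1 - 1 = k - 3 := by omega
    rw [e]
    have := Nat.choose_le_choose (k - 3) (show n - 3 - 1 ≤ n - 3 by omega)
    unfold deg at h
    omega)
  rw [hc2, hUc] at key
  refine key.trans_le ?_
  have e : k - 1 - 0 - 2 = k - 3 := by omega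
  rw [e]
  exact Nat.choose_le_choose _ (by omega)

lemma lemmaX {U : Finset ℕ} {n k : ℕ} (hk : 3 ≤ k) (hn : 36 * k < n) (hU : U.card = n - 2)
    {A B : Finset (Finset ℕ)} (hA : Unif U (k - 1) A) (hB : Unif U (k - 1) B)
    (hc : CrossT 1 A B) (hAc : 5 * (n - 3).choose (k - 3) ≤ A.card)
    (hBc : 5 * (n - 3).choose (k - 3) ≤ B.card) :
    ∃ z ∈ U, (A.filter (fun F => z ∉ F)).card < (n - 3).choose (k - 3) ∧
      (B.filter (fun F => z ∉ F)).card < (n - 3).choose (k - 3) := by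
  obtain ⟨E, hE⟩ : ∃ E, E = (n - 3).choose (k - 3) := ⟨_, rfl⟩
  have hE1 : 1 ≤ E := by rw [hE]; exact Nat.choose_pos (by omega)
  have hh : ∀ A B : Finset (Finset ℕ), Unif U (k - 1) A → Unif U (k - 1) B → CrossT 1 A B →
      ∀ z ∈ U, 2 * E < deg z A → (B.filter (fun F => z ∉ F)).card < E := by
    intro A B hA hB hc z hz h
    rw [hE] at h ⊢
    exact heavy_avoid hk hn hU hA hB hc hz h
  rw [← hE] at hAc hBc ⊢
  by_contra! hno
  have hlight : ∀ v ∈ U, deg v A ≤ 2 * E ∧ deg v B ≤ 2 * E := by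
    intro v hv
    constructor
    · by_contra! h
      have h1 := hh A B hA hB hc v hv h
      have h2 := deg_add_avoid v B
      have h3 := hh B A hB hA (cross_symm hc) v hv (by omega)
      have := hno v hv h3
      omega
    · by_contra! h
      have h1 := hh B A hB hA (cross_symm hc) v hv h
      have h2 := hno v hv h1
      have h3 := deg_add_avoid v A
      have h4 := hh A B hA hB hc v hv (by omega)
      omega
  obtain ⟨A', B', ⟨hA', hB', hc', hAc', hBc', hl'⟩, sA, sB⟩ := exists_stable U
    (fun A B => Unif U (k - 1) A ∧ Unif U (k - 1) B ∧ CrossT 1 A B ∧ 5 * E ≤ A.card ∧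
      5 * E ≤ B.card ∧ ∀ v ∈ U, deg v A ≤ 2 * E ∧ deg v B ≤ 2 * E) (by
    rintro A B ⟨hA, hB, hc, hAc, hBc, hl⟩ i hi j hj hij
    have uA := shiftS_unif (j := j) hA hi
    have uB := shiftS_unif (j := j) hB hi
    have cAB := shiftS_cross (i := i) (j := j) hc
    have nA := shiftS_card hij.ne A
    have nB := shiftS_card hij.ne B
    refine ⟨uA, uB, cAB, by omega, by omega, ?_⟩
    intro v hv
    by_cases hvi : v = i
    · subst hvi
      have dA := deg_shift_i (i := v) (j := j) A
      have dB := deg_shift_i (i := v) (j := j) B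
      have l1 := hl v hv
      have l2 := hl j hj
      have a1 := deg_add_avoid v (shiftS v j A)
      have a2 := deg_add_avoid v (shiftS v j B)
      constructor
      · by_contra! h
        have := hh _ _ uA uB cAB v hv h
        omega
      · by_contra! h
        have := hh _ _ uB uA (cross_symm cAB) v hv h
        omega
    · exact ⟨(deg_shift_le hvi A).trans (hl v hv).1, (deg_shift_le hvi B).trans (hl v hv).2⟩)
    _ A B rfl ⟨hA, hB, hc, hAc, hBc, hlight⟩
  have hUne : U.Nonempty := card_pos.1 (by omega)
  have hyU := U.min'_mem hUne
  obtain ⟨y, hy⟩ : ∃ y, y = U.min' hUne := ⟨_, rfl⟩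
  rw [← hy] at hyU
  have hmin : ∀ x ∈ U, y ≤ x := fun x hx => by rw [hy]; exact U.min'_le x hx
  have shA : Shifted U A' := fun F hF i hi j hj hij hiF =>
    sA F hF i hi j ((hA' F hF).1 hj) hij hj hiF
  have c2 := cross_avoid le_rfl hA' shA hc' hyU hmin
  have hcard : (U.erase y).card = n - 3 := by rw [card_erase_of_mem hyU, hU]; omega
  have := shifted_cross (by omega) (by omega) (unif_avoid hA' y) (unif_avoid hB' y)
    (shifted_avoid shA y) c2
  have e : k - 1 - (1 + 1) = k - 3 := by omega
  rw [hcard, e, ← hE] at this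
  have l := hl' y hyU
  have a1 := deg_add_avoid y A'
  have a2 := deg_add_avoid y B'
  omega

lemma swap_in (A : Finset (Finset ℕ)) (x y : ℕ) (O : List ℕ) : cl A [x, y] O = cl A [y, x] O :=
  cl_congr A (by intro z; simp; tauto) (by simp)

lemma swap_out (A : Finset (Finset ℕ)) (x y : ℕ) (I : List ℕ) : cl A I [x, y] = cl A I [y, x] :=
  cl_congr A (by simp) (by intro z; simp; tauto)

lemma X_fam {V : Finset ℕ} {n k p q : ℕ} (hk : 3 ≤ k) (hn : 36 * k < n) (hV : V.card = n)
    {𝓕 : Finset (Finset ℕ)} (hF : Unif V k 𝓕) (hi : CrossT 1 𝓕 𝓕)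
    (hp : p ∈ V) (hq : q ∈ V) (hpq : p ≠ q)
    (h1 : 5 * (n - 3).choose (k - 3) ≤ cl 𝓕 [p] [q])
    (h2 : 5 * (n - 3).choose (k - 3) ≤ cl 𝓕 [q] [p]) :
    ∃ z ∈ V, z ≠ p ∧ z ≠ q ∧ cl 𝓕 [p] [z, q] < (n - 3).choose (k - 3) ∧
      cl 𝓕 [q] [z, p] < (n - 3).choose (k - 3) := by
  obtain ⟨U, A, B, hU, hUc, uA, uB, c, cA, cB, aA, aB⟩ := link_pair hF hi [p] [q] [q] [p]
    (by simp [hpq]) (by simp [hpq.symm]) (by simp [hp, hq]) (by intro x; simp; tauto)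
    (by simp [hpq])
  simp only [List.length_singleton] at uA uB hUc
  obtain ⟨z, hz, hz1, hz2⟩ := lemmaX hk hn (by omega) uA uB c (by omega) (by omega)
  rw [aA z hz] at hz1
  rw [aB z hz] at hz2
  rw [hU] at hz
  simp at hz
  exact ⟨z, hz.1, hz.2.1, hz.2.2, hz1, hz2⟩

lemma kk_fam {V : Finset ℕ} {k : ℕ} (j : ℕ) {𝓕 : Finset (Finset ℕ)} (hF : Unif V k 𝓕)
    (hi : CrossT 1 𝓕 𝓕) (I O I' O' : List ℕ) (hn : (I ++ O).Nodup) (hn' : (I' ++ O').Nodup)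
    (hV : ∀ x ∈ I ++ O, x ∈ V)
    (hT : ∀ x, x ∈ I ∨ x ∈ O ↔ x ∈ I' ∨ x ∈ O') (hd : ∀ x ∈ I, x ∉ I')
    (hI : I.length < k) (hV2 : 2 * k + I.length + O.length ≤ V.card)
    (h : j * (V.card - (I.length + O.length) - 1).choose (k - I.length - 1) < cl 𝓕 I O) :
    cl 𝓕 I' O' < (V.card - (I.length + O.length) - j).choose (k - I'.length - j) := by
  obtain ⟨U, A, B, hU, hUc, uA, uB, c, cA, cB, aA, aB⟩ := link_pair hF hi I O I' O' hn hn' hV hT hd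
  have := kk_cross j uA uB c (by omega) (by omega) (by rw [cA, hUc]; exact h)
  rwa [cB, hUc] at this

/-- The hypothetical families of Lemma S. -/
def QF (V : Finset ℕ) (k s : ℕ) (G : Finset (Finset ℕ)) : Prop :=
  Unif V k G ∧ CrossT 1 G G ∧ G.card = s ∧ ∀ v ∈ V, 2 * deg v G ≤ s

lemma pair_small {V : Finset ℕ} {n k s x y : ℕ} (hk : 3 ≤ k) (hn : 36 * k < n) (hV : V.card = n)
    {G : Finset (Finset ℕ)} (hG : QF V k s G) (hs : 35 * (n - 3).choose (k - 3) ≤ s)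
    (hx : x ∈ V) (hy : y ∈ V) (hxy : x ≠ y) : cl G [x, y] [] ≤ 3 * (n - 3).choose (k - 3) := by
  obtain ⟨hF, hi, hc, hd⟩ := hG
  obtain ⟨E, hE⟩ : ∃ E, E = (n - 3).choose (k - 3) := ⟨_, rfl⟩
  have hE1 : 1 ≤ E := by rw [hE]; exact Nat.choose_pos (by omega)
  by_contra! h
  have h1 := kk_fam 3 hF hi [x, y] [] [] [x, y] (by simp [hxy]) (by simp [hxy]) (by simp [hx, hy])
    (by simp) (by simp) (by simp; omega) (by simp; omega) (by
      simp only [List.length_cons, List.length_nil, hV]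
      have e : n - (0 + 1 + 1 + 0) - 1 = n - 3 := by omega
      have e' : k - (0 + 1 + 1) - 1 = k - 3 := by omega
      rw [e, e']; exact h)
  have h2 : cl G [] [x, y] < E := by
    refine h1.trans_le ?_
    rw [hE]
    exact Nat.choose_le_choose _ (by simp; omega)
  rw [← hE] at h hs
  have s0 := cl_nil G
  have s1 := cl_split G [] [] x
  have s2 := cl_split G [] [] y
  have s3 := cl_split G [x] [] y
  have s4 := cl_split G [y] [] x
  have s5 := cl_split G [] [x] y
  have s6 := cl_split G [] [y] x
  have w1 := swap_in G y x []
  have w2 := swap_out G y x []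
  have d1 := hd x hx
  have d2 := hd y hy
  rw [← cl_deg] at d1 d2
  obtain ⟨z, hz, hzx, hzy, hz1, hz2⟩ := X_fam hk hn hV hF hi hx hy hxy (by rw [← hE]; omega)
    (by rw [← hE]; omega)
  rw [← hE] at hz1 hz2
  have d3 := hd z hz
  rw [← cl_deg] at d3
  have t1 := cl_split G [] [] z
  have t2 := cl_split G [] [z] x
  have t3 := cl_split G [x] [z] y
  have t4 := cl_split G [] [x, z] y
  have w3 := swap_out G y z [x]
  have w4 := swap_out G x z [y]
  have t5 : cl G [] [y, x, z] ≤ cl G [] [x, y] :=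
    cl_mono G (by simp) (by intro w; simp; tauto)
  have t6 : cl G [y, x] [z] ≤ cl G [x, y] [] :=
    cl_mono G (by intro w; simp; tauto) (by simp)
  omega

lemma one_heavy {V : Finset ℕ} {n k s x y : ℕ} (hk : 3 ≤ k) (hn : 36 * k < n) (hV : V.card = n)
    {G : Finset (Finset ℕ)} (hG : QF V k s G) (hs : 35 * (n - 3).choose (k - 3) ≤ s)
    (hx : x ∈ V) (hy : y ∈ V) (hxy : x ≠ y) (h : 8 * (n - 3).choose (k - 3) ≤ deg x G) :
    deg y G < 8 * (n - 3).choose (k - 3) := by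
  by_contra! h'
  have p := pair_small hk hn hV hG hs hx hy hxy
  rw [← cl_deg] at h h'
  have s3 := cl_split G [x] [] y
  have s4 := cl_split G [y] [] x
  have w1 := swap_in G y x []
  obtain ⟨z, hz, hzx, hzy, hz1, hz2⟩ := X_fam hk hn hV hG.1 hG.2.1 hx hy hxy (by omega)
    (by omega)
  have s5 := cl_split G [x] [y] z
  have p2 := pair_small hk hn hV hG hs hz hx hzx
  have t6 : cl G [z, x] [y] ≤ cl G [z, x] [] := cl_mono G (by simp) (by simp)
  omega

lemma deg_filter_le (v : ℕ) (A : Finset (Finset ℕ)) (p : Finset ℕ → Prop) [DecidablePred p] :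
    deg v (A.filter p) ≤ deg v A :=
  card_le_card (filter_subset_filter _ (filter_subset _ _))

lemma exists_min {U : Finset ℕ} (h : 0 < U.card) : ∃ y ∈ U, ∀ x ∈ U, y ≤ x :=
  ⟨U.min' (card_pos.1 h), U.min'_mem _, fun x hx => U.min'_le x hx⟩

lemma terminal {V : Finset ℕ} {n k s r c : ℕ} (hk : 3 ≤ k) (hn : 36 * k < n) (hV : V.card = n)
    (hs : 35 * (n - 3).choose (k - 3) ≤ s) (hr : r ∈ V)
    (H : ∀ G, QF V k s G → deg r G = c → ∀ v ∈ V, v ≠ r → deg v G < 8 * (n - 3).choose (k - 3))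
    (G₀ : Finset (Finset ℕ)) (hG₀ : QF V k s G₀) (hc₀ : deg r G₀ = c) : False := by
  obtain ⟨E, hE⟩ : ∃ E, E = (n - 3).choose (k - 3) := ⟨_, rfl⟩
  have hE1 : 1 ≤ E := by rw [hE]; exact Nat.choose_pos (by omega)
  rw [← hE] at hs H
  obtain ⟨A, B, ⟨-, hQ, hc⟩, st, -⟩ := exists_stable (V.erase r)
    (fun A B => A = B ∧ QF V k s A ∧ deg r A = c) (by
    rintro A B ⟨rfl, hQ, hc⟩ i hi j hj hij
    obtain ⟨hir, hi⟩ := mem_erase.1 hi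
    obtain ⟨hjr, hj⟩ := mem_erase.1 hj
    refine ⟨rfl, ⟨shiftS_unif hQ.1 hi, shiftS_cross hQ.2.1, ?_, ?_⟩, ?_⟩
    · rw [shiftS_card hij.ne]; exact hQ.2.2.1
    · intro v hv
      by_cases hvi : v = i
      · subst hvi
        have := deg_shift_i (i := v) (j := j) A
        have := H A hQ hc v hv hir
        have := H A hQ hc j hj hjr
        omega
      · have := deg_shift_le (j := j) hvi A
        have := hQ.2.2.2 v hv
        omega
    · rw [deg_shift_eq hij.ne hir.symm hjr.symm]; exact hc)
    _ G₀ G₀ rfl ⟨rfl, hG₀, hc₀⟩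
  have hu := unif_avoid hQ.1 r
  have hcr : CrossT 1 (A.filter (fun F => r ∉ F)) (A.filter (fun F => r ∉ F)) :=
    fun F hF F' hF' => hQ.2.1 F (mem_filter.1 hF).1 F' (mem_filter.1 hF').1
  have hsh : Shifted (V.erase r) (A.filter (fun F => r ∉ F)) := by
    intro F hF i hi j hj hij hiF
    have hjY := (hu F hF).1 hj
    obtain ⟨hF, hrF⟩ := mem_filter.1 hF
    rw [mem_filter]
    refine ⟨st F hF i hi j hjY hij hj hiF, ?_⟩
    have := ne_of_mem_erase hi
    simp [hrF, this.symm]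
  have hYc : (V.erase r).card = n - 1 := by rw [card_erase_of_mem hr, hV]
  have a0 := deg_add_avoid r A
  have d0 := hQ.2.2.2 r hr
  have hAc := hQ.2.2.1
  obtain ⟨G₁, hG₁⟩ : ∃ G₁, G₁ = A.filter (fun F => r ∉ F) := ⟨_, rfl⟩
  have m1 : ∀ v, deg v G₁ ≤ deg v A := fun v => by rw [hG₁]; exact deg_filter_le v A _
  rw [← hG₁] at hu hcr hsh a0
  obtain ⟨y, hy, hymin⟩ := exists_min (U := V.erase r) (by omega)
  have hu2 := unif_avoid hu y
  have hsh2 := shifted_avoid hsh y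
  have hc2 := cross_avoid le_rfl hu hsh hcr hy hymin
  have hYc2 : ((V.erase r).erase y).card = n - 2 := by rw [card_erase_of_mem hy, hYc]; omega
  have a1 := deg_add_avoid y G₁
  obtain ⟨G₂, hG₂⟩ : ∃ G₂, G₂ = G₁.filter (fun F => y ∉ F) := ⟨_, rfl⟩
  have m2 : ∀ v, deg v G₂ ≤ deg v G₁ := fun v => by rw [hG₂]; exact deg_filter_le v G₁ _
  rw [← hG₂] at hu2 hsh2 hc2 a1
  obtain ⟨z, hz, hzmin⟩ := exists_min (U := (V.erase r).erase y) (by omega)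
  have hu3 := unif_avoid hu2 z
  have hsh3 := shifted_avoid hsh2 z
  have hc3 := cross_avoid (by omega) hu2 hsh2 hc2 hz hzmin
  have hYc3 : (((V.erase r).erase y).erase z).card = n - 3 := by
    rw [card_erase_of_mem hz, hYc2]; omega
  have a2 := deg_add_avoid z G₂
  have key := shifted_cross (by omega) (by omega) hu3 hu3 hsh3 hc3
  have e : k - (1 + 1 + 1) = k - 3 := by omega
  rw [hYc3, e, ← hE, or_self] at key
  have b1 := H A hQ hc y (mem_of_mem_erase hy) (ne_of_mem_erase hy)
  have hz' := mem_of_mem_erase hz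
  have b2 := H A hQ hc z (mem_of_mem_erase hz') (ne_of_mem_erase hz')
  have := m1 y
  have := m1 z
  have := m2 z
  omega

lemma lemmaS {V : Finset ℕ} {n k s : ℕ} (hk : 3 ≤ k) (hn : 36 * k < n) (hV : V.card = n)
    (hs : 35 * (n - 3).choose (k - 3) ≤ s) (G : Finset (Finset ℕ)) (hG : QF V k s G) : False := by
  by_cases h : ∃ G', QF V k s G' ∧ ∃ r ∈ V, 8 * (n - 3).choose (k - 3) ≤ deg r G'
  · obtain ⟨G', hG', r, hr, hd⟩ := h
    refine terminal (c := deg r G') hk hn hV hs hr ?_ G' hG' rfl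
    intro G'' hG'' he v hv hvr
    exact one_heavy hk hn hV hG'' hs hr hv hvr.symm (by omega)
  · push Not at h
    obtain ⟨r, hr⟩ : V.Nonempty := card_pos.1 (by omega)
    exact terminal (c := deg r G) hk hn hV hs hr (fun G' hG' _ v hv _ => h G' hG' v hv) G hG rfl

lemma triple {V : Finset ℕ} {n k x y z : ℕ} (hk : 3 ≤ k) (hn : 36 * k < n) (hV : V.card = n)
    {𝓕 : Finset (Finset ℕ)} (hF : Unif V k 𝓕) (hi : CrossT 1 𝓕 𝓕)
    (hx : x ∈ V) (hy : y ∈ V) (hz : z ∈ V) (hxy : x ≠ y) (hxz : x ≠ z) (hyz : y ≠ z)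
    (h : 3 * (n - 3).choose (k - 3) < cl 𝓕 [x, y] [z]) :
    cl 𝓕 [x, y] [z] + 2 * cl 𝓕 [z] [x, y] + cl 𝓕 [] [x, y, z] ≤ (n - 3).choose (k - 2) := by
  have hle := Nat.choose_le_choose (k - 3) (show n - 3 - 1 ≤ n - 3 by omega)
  have e1 : k - 2 - 1 = k - 3 := by omega
  have i1 : cl 𝓕 [x, y] [z] + 8 * cl 𝓕 [z] [x, y] ≤ (n - 3).choose (k - 2) := by
    obtain ⟨U, A, B, hU, hUc, uA, uB, c, cA, cB, aA, aB⟩ := link_pair hF hi [x, y] [z] [z] [x, y]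
      (by simp; tauto) (by simp; tauto) (by simp; tauto) (by intro w; simp; tauto)
      (by simp; tauto)
    simp only [List.length_cons, List.length_nil, zero_add, hV] at uA uB hUc
    have hUc : U.card = n - 3 := by omega
    have uA : Unif U (k - 2) A := uA
    have b := kk_cross 2 uA uB c (by omega) (by omega) (by rw [cA, hUc, e1]; omega)
    have e2 : k - 1 - 2 = k - 2 - 1 := by omega
    rw [e2] at b
    have := weighted (i := 2) uA uB c (by omega) (by omega) (by omega) (by omega) b
    rwa [cA, cB, hUc] at this
  have i2 : cl 𝓕 [x, y] [z] + 8 * cl 𝓕 [] [x, y, z] ≤ (n - 3).choose (k - 2) := by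
    obtain ⟨U, A, B, hU, hUc, uA, uB, c, cA, cB, aA, aB⟩ := link_pair hF hi [x, y] [z] [] [x, y, z]
      (by simp; tauto) (by simp; tauto) (by simp; tauto) (by intro w; simp; tauto)
      (by simp)
    simp only [List.length_cons, List.length_nil, zero_add, hV] at uA uB hUc
    have hUc : U.card = n - 3 := by omega
    have uA : Unif U (k - 2) A := uA
    have b := kk_cross 3 uA uB c (by omega) (by omega) (by rw [cA, hUc, e1]; omega)
    have e2 : k - 0 - 3 = k - 2 - 1 := by omega
    rw [e2] at b
    have := weighted (i := 3) uA uB c (by omega) (by omega) (by omega) (by omega) b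
    rwa [cA, cB, hUc] at this
  omega

lemma choose_ratio {n k : ℕ} (hk : 3 ≤ k) (hn : 36 * k < n) :
    35 * (n - 3).choose (k - 3) ≤ (n - 3).choose (k - 2) := by
  have := Nat.choose_succ_right_eq (n - 3) (k - 3)
  have e : k - 3 + 1 = k - 2 := by omega
  rw [e] at this
  have h6 : 35 * (k - 2) ≤ n - 3 - (k - 3) := by omega
  have h7 : 35 * (k - 2) * (n - 3).choose (k - 3) ≤ (n - 3).choose (k - 2) * (k - 2) := by
    rw [this, mul_comm]; exact Nat.mul_le_mul_left _ h6
  have h8 : 0 < k - 2 := by omega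
  nlinarith

lemma main_ge_three {V : Finset ℕ} {n k : ℕ} (hk : 3 ≤ k) (hn : 36 * k < n) (hV : V.card = n)
    {𝓕 : Finset (Finset ℕ)} (hF : Unif V k 𝓕) (hi : CrossT 1 𝓕 𝓕)
    (hdiv : ∀ i ∈ V, (n - 3).choose (k - 2) < cl 𝓕 [] [i]) : False := by
  have hr := choose_ratio hk hn
  obtain ⟨E, hE⟩ : ∃ E, E = (n - 3).choose (k - 3) := ⟨_, rfl⟩
  have hE1 : 1 ≤ E := by rw [hE]; exact Nat.choose_pos (by omega)
  obtain ⟨D, hD⟩ : ∃ D, D = (n - 3).choose (k - 2) := ⟨_, rfl⟩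
  have hT : ∀ x ∈ V, ∀ y ∈ V, ∀ z ∈ V, x ≠ y → x ≠ z → y ≠ z → 3 * E < cl 𝓕 [x, y] [z] →
      cl 𝓕 [x, y] [z] + 2 * cl 𝓕 [z] [x, y] + cl 𝓕 [] [x, y, z] ≤ D := by
    intro x hx y hy z hz hxy hxz hyz h
    rw [hD]
    exact triple hk hn hV hF hi hx hy hz hxy hxz hyz (by rw [← hE]; exact h)
  obtain ⟨p, hp, hmax⟩ := exists_max_image V (fun v => deg v 𝓕) (card_pos.1 (by omega))
  have hdp := hdiv p hp
  obtain ⟨q, hq, hqd⟩ : ∃ q ∈ V, cl 𝓕 [] [p] < 2 * deg q (fam 𝓕 [] [p]) := by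
    by_contra! h
    exact lemmaS hk hn hV (by omega) (fam 𝓕 [] [p])
      (s := cl 𝓕 [] [p]) ⟨fam_unif hF _ _, fam_cross hi _ _ _ _, rfl, h⟩
  have hdq : deg q (fam 𝓕 [] [p]) = cl 𝓕 [q] [p] := by
    unfold deg cl fam
    rw [filter_filter]
    congr 1
    apply filter_congr
    intro F hF
    simp
    tauto
  have hqp : p ≠ q := by
    rintro rfl
    have : cl 𝓕 [p] [p] = 0 := by
      unfold cl fam
      rw [card_eq_zero, filter_eq_empty_iff]
      intro F hF
      simp
    omega
  rw [hdq] at hqd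
  have hm := hmax q hq
  rw [← cl_deg, ← cl_deg] at hm
  have s1 := cl_split 𝓕 [p] [] q
  have s2 := cl_split 𝓕 [q] [] p
  have w1 := swap_in 𝓕 p q []
  obtain ⟨r, hrV, hrp, hrq, hr1, hr2⟩ := X_fam hk hn hV hF hi hp hq hqp (by omega) (by omega)
  rw [← hE] at hr1 hr2 hr
  rw [← hD] at hr
  have hdq := hdiv q hq
  have hdr := hdiv r hrV
  rw [← hD] at hdq hdr hdp
  have s3 := cl_split 𝓕 [p] [q] r
  have s4 := cl_split 𝓕 [q] [p] r
  have T1 := hT r hrV p hp q hq hrp hrq hqp (by omega)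
  have T2 := hT r hrV q hq p hp hrq hrp hqp.symm (by omega)
  have o1 : cl 𝓕 [] [r, q, p] = cl 𝓕 [] [r, p, q] :=
    cl_congr 𝓕 (by simp) (by intro w; simp; tauto)
  have o2 : cl 𝓕 [] [q, p, r] = cl 𝓕 [] [r, p, q] :=
    cl_congr 𝓕 (by simp) (by intro w; simp; tauto)
  have hC : cl 𝓕 [] [r, p, q] < E := by
    have h1 := kk_fam 3 hF hi [r, p] [q] [] [r, p, q] (by simp; tauto) (by simp; tauto)
      (by simp; tauto) (by intro w; simp; tauto) (by simp) (by simp; omega) (by simp; omega) (by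
      simp only [List.length_cons, List.length_nil, hV]
      have e' : k - (0 + 1 + 1) - 1 = k - 3 := by omega
      rw [e']
      have : (n - (0 + 1 + 1 + (0 + 1)) - 1).choose (k - 3) ≤ E := by
        rw [hE]; exact Nat.choose_le_choose _ (by omega)
      omega)
    refine h1.trans_le ?_
    rw [hE]
    exact Nat.choose_le_choose _ (by simp; omega)
  have u1 := cl_split 𝓕 [] [r] p
  have u2 := cl_split 𝓕 [p] [r] q
  have u3 := cl_split 𝓕 [] [p, r] q
  have w2 := swap_out 𝓕 p r [q]
  have w3 := swap_out 𝓕 q r [p]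
  have T3 := hT q hq p hp r hrV hqp.symm hrq.symm hrp.symm (by omega)
  have v1 := cl_split 𝓕 [] [p] q
  have v2 := cl_split 𝓕 [] [q, p] r
  have x1 := cl_split 𝓕 [] [q] p
  have x2 := cl_split 𝓕 [] [p, q] r
  have w4 := swap_out 𝓕 p q [r]
  omega

theorem stmt_8 (n k : ℕ) (hn : 36 * k < n) (𝓕 : Finset (Finset ℕ))
    (h𝓕 : ∀ F ∈ 𝓕, F ⊆ Finset.Icc 1 n ∧ F.card = k)
    (hint : ∀ F ∈ 𝓕, ∀ F' ∈ 𝓕, (F ∩ F').Nonempty) :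
    ∃ i ∈ Finset.Icc 1 n, (𝓕.filter (fun F => i ∉ F)).card ≤ (n - 3).choose (k - 2) := by
  have hV : (Finset.Icc 1 n).card = n := by simp
  by_contra! h
  have hcl : ∀ i ∈ Finset.Icc 1 n, (n - 3).choose (k - 2) < cl 𝓕 [] [i] := by
    intro i hi
    have := h i hi
    simpa [cl, fam] using this
  by_cases hk : 3 ≤ k
  · exact main_ge_three hk hn hV h𝓕 (fun F hF F' hF' => card_pos.2 (hint F hF F' hF')) hcl
  · have e : k - 2 = 0 := by omega
    rw [e] at h
    simp only [Nat.choose_zero_right] at h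
    have h1 := h 1 (by simp; omega)
    obtain ⟨F, hF, -⟩ := exists_mem_ne h1 ∅
    have hF := (mem_filter.1 hF).1
    have hFc := (h𝓕 F hF).2
    have hFs := (h𝓕 F hF).1
    obtain ⟨a, ha⟩ := hint F hF F hF
    rw [inter_self] at ha
    have hka : k ≠ 0 := by
      intro h0
      rw [h0, card_eq_zero] at hFc
      simp [hFc] at ha
    -- a set avoiding `a`, and one avoiding a further element
    have h2 := h a (hFs ha)
    obtain ⟨G, hG, H, hH, hGH⟩ := one_lt_card.1 h2
    obtain ⟨hG, haG⟩ := mem_filter.1 hG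
    obtain ⟨hH, haH⟩ := mem_filter.1 hH
    obtain ⟨b, hb⟩ := hint F hF G hG
    rw [mem_inter] at hb
    have hab : a ≠ b := fun e => haG (e ▸ hb.2)
    have hpair : ({a, b} : Finset ℕ) ⊆ F := by
      intro x hx
      simp only [mem_insert, mem_singleton] at hx
      rcases hx with rfl | rfl
      · exact ha
      · exact hb.1
    have hk2 : k = 2 := by
      have := card_le_card hpair
      rw [card_pair hab] at this
      omega
    have hFe : F = {a, b} := (eq_of_subset_of_card_le hpair (by rw [card_pair hab]; omega)).symm
    have h3 := h b (hFs hb.1)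
    obtain ⟨K, hK, -⟩ := exists_mem_ne h3 ∅
    obtain ⟨hK, hbK⟩ := mem_filter.1 hK
    have hbH : b ∈ H := by
      obtain ⟨x, hx⟩ := hint F hF H hH
      rw [mem_inter, hFe] at hx
      simp only [mem_insert, mem_singleton] at hx
      rcases hx.1 with rfl | rfl
      · exact absurd hx.2 haH
      · exact hx.2
    have haK : a ∈ K := by
      obtain ⟨x, hx⟩ := hint F hF K hK
      rw [mem_inter, hFe] at hx
      simp only [mem_insert, mem_singleton] at hx
      rcases hx.1 with rfl | rfl
      · exact hx.2
      · exact absurd hx.2 hbK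
    obtain ⟨c, hc⟩ := hint G hG K hK
    obtain ⟨d, hd⟩ := hint H hH K hK
    rw [mem_inter] at hc hd
    have hca : c ≠ a := fun e => haG (e ▸ hc.1)
    have hda : d ≠ a := fun e => haH (e ▸ hd.1)
    have hcb : c ≠ b := fun e => hbK (e ▸ hc.2)
    have hdb : d ≠ b := fun e => hbK (e ▸ hd.2)
    have pair_eq : ∀ S ∈ 𝓕, ∀ x ∈ S, ∀ y ∈ S, x ≠ y → S = {x, y} := by
      intro S hS x hx y hy hxy
      symm
      apply eq_of_subset_of_card_le
      · intro w hw
        simp only [mem_insert, mem_singleton] at hw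
        rcases hw with rfl | rfl <;> assumption
      · rw [card_pair hxy, (h𝓕 S hS).2]; omega
    have e1 := pair_eq K hK a haK c hc.2 hca.symm
    have hdc : d = c := by
      have := hd.2
      rw [e1] at this
      simpa [hda] using this
    subst hdc
    apply hGH
    rw [pair_eq G hG d hc.1 b hb.2 hcb, pair_eq H hH d hd.1 b hbH hcb]
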